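/- For every real α with 0 < α < 1, the series Σ_{k=0}^∞ Γ(2k+α)/Γ(2k+2) converges and (1 − α)·Σ_{k=0}^∞ Γ(2k+α)/Γ(2k+2) = Γ(α)·2^{-α}, where Γ is the real Gamma function. -/

import Mathlib

open Filter Finset

theorem hasSum_of_tendsto_powerSeries_of_nonneg {d : ℕ → ℝ} (hd : ∀ k, 0 ≤ d k) {e : ℕ → ℕ}
    {g : ℝ → ℝ} {L : ℝ} (hg : Tendsto g (nhdsWithin 1 (Set.Iio 1)) (nhds L))
    (hs : ∀ x ∈ Set.Ioo (0 : ℝ) 1, HasSum (fun k => d k * x ^ e k) (g x)) :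
    HasSum d L := by
  have hev : ∀ᶠ x in nhdsWithin (1 : ℝ) (Set.Iio 1), x ∈ Set.Ioo (0 : ℝ) 1 :=
    Ioo_mem_nhdsLT one_pos
  have hle : ∀ u : Finset ℕ, ∑ k ∈ u, d k ≤ L := by
    intro u
    have hc : Continuous (fun x : ℝ => ∑ k ∈ u, d k * x ^ e k) := by fun_prop
    have ht := hc.continuousWithinAt (s := Set.Iio 1) (x := 1)
    have ht' : Tendsto (fun x : ℝ => ∑ k ∈ u, d k * x ^ e k) (nhdsWithin 1 (Set.Iio 1))
        (nhds (∑ k ∈ u, d k)) := by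
      simpa [ContinuousWithinAt] using ht
    refine le_of_tendsto_of_tendsto ht' hg ?_
    filter_upwards [hev] with x hx
    exact sum_le_hasSum u (fun k _ => mul_nonneg (hd k) (pow_nonneg hx.1.le _)) (hs x hx)
  have hsum : Summable d := summable_of_sum_le hd hle
  have heq : ∑' k, d k = L := by
    refine le_antisymm (hsum.tsum_le_of_sum_le hle) (le_of_tendsto hg ?_)
    filter_upwards [hev] with x hx
    refine hasSum_le (fun k => ?_) (hs x hx) hsum.hasSum
    exact mul_le_of_le_one_right (hd k) (pow_le_one₀ hx.1.le hx.2.le)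
  exact heq ▸ hsum.hasSum

theorem Real.hasSum_choose_mul_pow (a : ℝ) {x : ℝ} (hx : |x| < 1) :
    HasSum (fun n : ℕ => Ring.choose a n * x ^ n) ((1 + x) ^ a) := by
  have h := (Real.one_add_rpow_hasFPowerSeriesOnBall_zero (a := a)).hasSum (y := x)
    (by simpa [enorm_eq_nnnorm, ← NNReal.coe_lt_one] using hx)
  simpa [binomialSeries, FormalMultilinearSeries.coeff_ofScalars, mul_comm] using h

theorem Real.hasSum_choose_odd_mul_pow (a : ℝ) {x : ℝ} (hx : |x| < 1) :
    HasSum (fun k : ℕ => Ring.choose a (2 * k + 1) * x ^ (2 * k + 1))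
      (((1 + x) ^ a - (1 - x) ^ a) / 2) := by
  have h := ((Real.hasSum_choose_mul_pow a hx).sub
    (Real.hasSum_choose_mul_pow a (x := -x) (by simpa using hx))).div_const 2
  have hinj : Function.Injective (fun k : ℕ => 2 * k + 1) := fun m n h => by
    simpa using h
  rw [← hinj.hasSum_iff] at h
  · rw [← sub_eq_add_neg] at h
    refine Eq.mp (congrArg (HasSum · _) (funext fun k => ?_)) h
    simp only [Function.comp_apply, Odd.neg_pow (odd_two_mul_add_one k)]
    ring
  · intro n hn
    have : Even n := by
      by_contra ho
      obtain ⟨k, hk⟩ := Nat.not_even_iff_odd.mp ho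
      exact hn ⟨k, hk.symm⟩
    simp [this.neg_pow]

theorem Ring.succ_mul_choose_succ {K : Type*} [Field K] [CharZero K] (a : K) (n : ℕ) :
    ((n : K) + 1) * Ring.choose a (n + 1) = (a - n) * Ring.choose a n := by
  have h := Ring.choose_smul_choose a (Nat.le_succ n)
  simpa [Ring.choose_one_right, mul_comm] using h

theorem Real.one_sub_mul_Gamma_div_Gamma {α : ℝ} (h0 : 0 < α) (n : ℕ) :
    (1 - α) * (Real.Gamma (n + α) / Real.Gamma (n + 2)) =
      Real.Gamma α * ((-1) ^ n * Ring.choose (1 - α) (n + 1)) := by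
  induction n with
  | zero => simp [mul_comm]
  | succ n ih =>
    have hG1 : Real.Gamma ((n : ℝ) + 1 + α) = (n + α) * Real.Gamma (n + α) := by
      rw [← Real.Gamma_add_one (by positivity)]; ring_nf
    have hG2 : Real.Gamma ((n : ℝ) + 1 + 2) = (n + 2) * Real.Gamma (n + 2) := by
      rw [← Real.Gamma_add_one (by positivity)]; ring_nf
    have hc := Ring.succ_mul_choose_succ (1 - α) (n + 1)
    have hpos : Real.Gamma ((n : ℝ) + 2) ≠ 0 := (Real.Gamma_pos_of_pos (by positivity)).ne'
    have hn : (n : ℝ) + 2 ≠ 0 := by positivity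
    push_cast at hc ⊢
    rw [hG1, hG2, mul_div_mul_comm, mul_left_comm, ih, pow_succ, div_mul_eq_mul_div,
      div_eq_iff hn]
    linear_combination (Real.Gamma α * (-1) ^ n) * hc

theorem stmt6 (α : ℝ) (h0 : 0 < α) (h1 : α < 1) :
    Summable (fun k : ℕ => Real.Gamma (2 * (k : ℝ) + α) / Real.Gamma (2 * (k : ℝ) + 2)) ∧
    (1 - α) * ∑' k : ℕ, Real.Gamma (2 * (k : ℝ) + α) / Real.Gamma (2 * (k : ℝ) + 2) =
      Real.Gamma α * (2 : ℝ) ^ (-α) := by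
  have hα : 0 < 1 - α := sub_pos.mpr h1
  have hΓ : 0 < Real.Gamma α := Real.Gamma_pos_of_pos h0
  have key : ∀ k : ℕ, (1 - α) * (Real.Gamma (2 * (k : ℝ) + α) / Real.Gamma (2 * (k : ℝ) + 2)) =
      Real.Gamma α * Ring.choose (1 - α) (2 * k + 1) := fun k => by
    simpa using Real.one_sub_mul_Gamma_div_Gamma h0 (2 * k)
  have hnonneg : ∀ k : ℕ, 0 ≤ Ring.choose (1 - α) (2 * k + 1) := fun k => by
    rw [← mul_nonneg_iff_of_pos_left hΓ, ← key]
    exact mul_nonneg hα.le (div_nonneg (Real.Gamma_nonneg_of_nonneg (by positivity))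
      (Real.Gamma_nonneg_of_nonneg (by positivity)))
  have hlim : Tendsto (fun x : ℝ => ((1 + x) ^ (1 - α) - (1 - x) ^ (1 - α)) / 2)
      (nhdsWithin 1 (Set.Iio 1)) (nhds (2 ^ (-α))) := by
    have hc : Continuous (fun x : ℝ => ((1 + x) ^ (1 - α) - (1 - x) ^ (1 - α)) / 2) :=
      (((continuous_const.add continuous_id).rpow_const fun _ => Or.inr hα.le).sub
        ((continuous_const.sub continuous_id).rpow_const fun _ => Or.inr hα.le)).div_const 2
    have hv : ((1 + 1 : ℝ) ^ (1 - α) - (1 - 1) ^ (1 - α)) / 2 = 2 ^ (-α) := by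
      rw [sub_self, Real.zero_rpow hα.ne', one_add_one_eq_two, sub_eq_neg_add 1 α,
        Real.rpow_add_one two_ne_zero]
      ring
    exact hv ▸ (hc.tendsto 1).mono_left nhdsWithin_le_nhds
  have hsum := (hasSum_of_tendsto_powerSeries_of_nonneg hnonneg hlim fun x hx =>
    Real.hasSum_choose_odd_mul_pow _ (abs_lt.mpr ⟨by linarith [hx.1], hx.2⟩)).mul_left
      (Real.Gamma α)
  simp only [← key] at hsum
  exact ⟨(summable_mul_left_iff hα.ne').mp hsum.summable, by rw [← tsum_mul_left, hsum.tsum_eq]⟩
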